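/- Let Ω ⊂ ℝⁿ be open and let φ : Ω → ℝ be a convex function whose Monge–Ampère measure μ_φ has nontrivial singular part μ_φ^s with respect to Lebesgue measure. Then for every sequence of smooth convex functions φ_j converging locally uniformly to φ, every z₀ ∈ supp(μ_φ^s), and every ball B_r(z₀) compactly contained in Ω, one has ‖det(Hφ_j)‖_{H¹(B_r(z₀))} → +∞ as j → ∞, where ‖g‖_{H¹} = ∫ g log(1+g) for nonnegative g. -/

import Mathlib

open MeasureTheory RealInnerProductSpace

/-- The subdifferential of `φ` at `x`, relative to the set `Ω`. -/
def subdiffOn {n : ℕ} (Ω : Set (EuclideanSpace ℝ (Fin n)))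
    (φ : EuclideanSpace ℝ (Fin n) → ℝ) (x : EuclideanSpace ℝ (Fin n)) :
    Set (EuclideanSpace ℝ (Fin n)) :=
  {y | ∀ z ∈ Ω, φ x + ⟪y, z - x⟫ ≤ φ z}

/-- The pointwise Hessian matrix of `u : ℝⁿ → ℝ`. -/
noncomputable def Hess {n : ℕ} (u : EuclideanSpace ℝ (Fin n) → ℝ)
    (x : EuclideanSpace ℝ (Fin n)) : Matrix (Fin n) (Fin n) ℝ :=
  Matrix.of fun i j =>
    fderiv ℝ (fun y => fderiv ℝ u y (EuclideanSpace.single j 1)) x (EuclideanSpace.single i 1)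

theorem hess_apply {n : ℕ} {u : EuclideanSpace ℝ (Fin n) → ℝ} {x : EuclideanSpace ℝ (Fin n)}
    (hu : DifferentiableAt ℝ (fderiv ℝ u) x) (i j : Fin n) :
    Hess u x i j = fderiv ℝ (fderiv ℝ u) x (EuclideanSpace.single i 1)
      (EuclideanSpace.single j 1) := by
  simp only [Hess, Matrix.of_apply]
  rw [fderiv_clm_apply hu (differentiableAt_const _)]
  simp

theorem hasFDerivAt_gradient {n : ℕ} {u : EuclideanSpace ℝ (Fin n) → ℝ}
    {x : EuclideanSpace ℝ (Fin n)} (hu : DifferentiableAt ℝ (fderiv ℝ u) x) :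
    HasFDerivAt (gradient u)
      ((InnerProductSpace.toDual ℝ (EuclideanSpace ℝ (Fin n))).symm.toContinuousLinearEquiv
        |>.toContinuousLinearMap.comp (fderiv ℝ (fderiv ℝ u) x)) x :=
  ContinuousLinearMap.hasFDerivAt
    ((InnerProductSpace.toDual ℝ (EuclideanSpace ℝ (Fin n))).symm.toContinuousLinearEquiv
      |>.toContinuousLinearMap) |>.comp x hu.hasFDerivAt

theorem det_fderiv_gradient {n : ℕ} {u : EuclideanSpace ℝ (Fin n) → ℝ}
    {x : EuclideanSpace ℝ (Fin n)} (hu : DifferentiableAt ℝ (fderiv ℝ u) x) :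
    (fderiv ℝ (gradient u) x).det = (Hess u x).det := by
  rw [(hasFDerivAt_gradient hu).fderiv, ContinuousLinearMap.det,
    ← LinearMap.det_toMatrix (EuclideanSpace.basisFun (Fin n) ℝ).toBasis, ← Matrix.det_transpose]
  congr 1
  ext i j
  rw [hess_apply hu, Matrix.transpose_apply, LinearMap.toMatrix_apply,
    OrthonormalBasis.coe_toBasis_repr_apply, OrthonormalBasis.repr_apply_apply]
  simp only [OrthonormalBasis.coe_toBasis, EuclideanSpace.basisFun_apply]
  rw [real_inner_comm]
  exact InnerProductSpace.toDual_symm_apply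

theorem ConvexOn.fderiv_fderiv_nonneg {E : Type*} [NormedAddCommGroup E] [NormedSpace ℝ E]
    {Ω : Set E} (hΩ : IsOpen Ω) {u : E → ℝ} (hu : ConvexOn ℝ Ω u)
    (hd : DifferentiableOn ℝ u Ω) {x : E} (hx : x ∈ Ω)
    (hd2 : DifferentiableAt ℝ (fderiv ℝ u) x) (v : E) :
    0 ≤ fderiv ℝ (fderiv ℝ u) x v v := by
  let L : ℝ →ᵃ[ℝ] E := AffineMap.lineMap x (x + v)
  have hL : ∀ t, HasDerivAt L v t := fun t => by
    simpa [L] using (AffineMap.hasDerivAt_lineMap (a := x) (b := x + v) (x := t))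
  have hL0 : L 0 = x := by simp [L]
  have hS : IsOpen (L ⁻¹' Ω) :=
    hΩ.preimage (continuous_iff_continuousAt.2 fun t => (hL t).continuousAt)
  have hg : ∀ t ∈ L ⁻¹' Ω, HasDerivAt (u ∘ L) (fderiv ℝ u (L t) v) t := fun t ht =>
    ((hd.differentiableAt (hΩ.mem_nhds ht)).hasFDerivAt).comp_hasDerivAt t (hL t)
  have hmono : MonotoneOn (fun t => fderiv ℝ u (L t) v) (L ⁻¹' Ω) :=
    ((hu.comp_affineMap L).monotoneOn_deriv fun t ht => (hg t ht).differentiableAt).congr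
      fun t ht => (hg t ht).deriv
  have h0 : (0 : ℝ) ∈ L ⁻¹' Ω := by simpa [hL0] using hx
  have hD : HasDerivAt (fun t => fderiv ℝ u (L t) v) (fderiv ℝ (fderiv ℝ u) x v v) 0 := by
    have h1 : HasFDerivAt (fderiv ℝ u) (fderiv ℝ (fderiv ℝ u) x) (L 0) := by
      rw [hL0]; exact hd2.hasFDerivAt
    simpa using (h1.comp_hasDerivAt (0 : ℝ) (hL 0)).clm_apply (hasDerivAt_const (0 : ℝ) v)
  have := hmono.derivWithin_nonneg (x := 0)
  rwa [derivWithin_of_isOpen hS h0, hD.deriv] at this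

theorem ConvexOn.hess_det_nonneg {n : ℕ} {Ω : Set (EuclideanSpace ℝ (Fin n))} (hΩ : IsOpen Ω)
    {u : EuclideanSpace ℝ (Fin n) → ℝ} (hu : ConvexOn ℝ Ω u) (hs : ContDiffOn ℝ 2 u Ω)
    {x : EuclideanSpace ℝ (Fin n)} (hx : x ∈ Ω) : 0 ≤ (Hess u x).det := by
  have hc : ContDiffAt ℝ 2 u x := hs.contDiffAt (hΩ.mem_nhds hx)
  have hd2 : DifferentiableAt ℝ (fderiv ℝ u) x :=
    (hc.fderiv_right (m := 1) (by norm_num)).differentiableAt (by norm_num)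
  refine (Matrix.PosSemidef.of_dotProduct_mulVec_nonneg ?_ fun w => ?_).det_nonneg
  · ext i j
    rw [Matrix.conjTranspose_apply, star_trivial, hess_apply hd2, hess_apply hd2]
    exact hc.isSymmSndFDerivAt (by simp) _ _
  · have hw : WithLp.toLp 2 w = ∑ i, w i • (EuclideanSpace.single i (1 : ℝ)) := by
      ext k
      simp [Finset.sum_apply, Pi.single_apply]
    have := hu.fderiv_fderiv_nonneg hΩ (hs.differentiableOn (by norm_num)) hx hd2
      (WithLp.toLp 2 w)
    rw [hw] at this
    simp only [map_sum, map_smul, sum_apply, smul_apply,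
      smul_eq_mul] at this
    simp only [star_trivial, dotProduct, Matrix.mulVec, hess_apply hd2]
    refine le_of_le_of_eq this ?_
    simp only [Finset.mul_sum]
    rw [Finset.sum_comm]
    exact Finset.sum_congr rfl fun i _ => Finset.sum_congr rfl fun j _ => by ring

/-- Almost every slope is attained by at most one supporting point of a continuous function on a
compact set: the Legendre transform is Lipschitz, hence differentiable almost everywhere, and its
gradient is the only possible maximizer. -/
theorem IsCompact.ae_subsingleton_isMaxOn {E : Type*} [NormedAddCommGroup E]
    [InnerProductSpace ℝ E] [FiniteDimensional ℝ E] [MeasurableSpace E] [BorelSpace E]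
    {D : Set E} (hD : IsCompact D) {φ : E → ℝ} (hφ : ContinuousOn φ D) (ν : Measure E)
    [ν.IsAddHaarMeasure] :
    ∀ᵐ p ∂ν, {x ∈ D | IsMaxOn (fun z => ⟪p, z⟫ - φ z) D x}.Subsingleton := by
  rcases D.eq_empty_or_nonempty with rfl | hne
  · simp
  obtain ⟨R, hR⟩ := hD.isBounded.exists_norm_le
  have hbdd : ∀ p : E, BddAbove ((fun z => ⟪p, z⟫ - φ z) '' D) := fun p =>
    hD.bddAbove_image ((by fun_prop : Continuous fun z : E => ⟪p, z⟫).continuousOn.sub hφ)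
  let g : E → ℝ := fun p => sSup ((fun z => ⟪p, z⟫ - φ z) '' D)
  have hle : ∀ p, ∀ x ∈ D, ⟪p, x⟫ - φ x ≤ g p := fun p x hx =>
    le_csSup (hbdd p) (Set.mem_image_of_mem _ hx)
  have hlip : LipschitzWith R.toNNReal g := by
    refine LipschitzWith.of_le_add_mul _ fun p q => csSup_le (hne.image _) ?_
    rintro _ ⟨z, hz, rfl⟩
    have h1 : ⟪p - q, z⟫ ≤ dist p q * R := by
      rw [dist_eq_norm]
      exact (real_inner_le_norm _ _).trans
        (mul_le_mul_of_nonneg_left (hR z hz) (norm_nonneg _))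
    have h2 := hle q z hz
    have h3 : R ≤ R.toNNReal := Real.le_coe_toNNReal R
    have h4 : dist p q * R ≤ R.toNNReal * dist p q := by
      rw [mul_comm]; exact mul_le_mul_of_nonneg_right h3 dist_nonneg
    rw [inner_sub_left] at h1
    simp only
    linarith
  filter_upwards [hlip.ae_differentiableAt (μ := ν)] with p hp
  have key : ∀ x ∈ D, IsMaxOn (fun z => ⟪p, z⟫ - φ z) D x → fderiv ℝ g p = innerSL ℝ x := by
    intro x hx hmax
    have hgp : g p = ⟪p, x⟫ - φ x := by
      refine le_antisymm (csSup_le (hne.image _) ?_) (hle p x hx)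
      rintro _ ⟨z, hz, rfl⟩
      exact hmax hz
    have hmin : IsLocalMin (fun q => g q - innerSL ℝ x q) p := by
      refine Filter.Eventually.of_forall fun q => ?_
      have := hle q x hx
      simp only [innerSL_apply_apply]
      rw [hgp, real_inner_comm, real_inner_comm q x]
      linarith
    have := hmin.hasFDerivAt_eq_zero (hp.hasFDerivAt.sub (innerSL ℝ x).hasFDerivAt)
    exact sub_eq_zero.1 this
  rintro x ⟨hx, hxm⟩ y ⟨hy, hym⟩
  have h : innerSL ℝ x = innerSL ℝ y := (key x hx hxm).symm.trans (key y hy hym)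
  exact ext_inner_right ℝ fun v => by simpa using congrArg (fun f => f v) h

/-- A slope whose supporting point is unique is eventually a slope of the approximants nearby. -/
theorem eventually_mem_image_gradient {E : Type*} [NormedAddCommGroup E]
    [InnerProductSpace ℝ E] [FiniteDimensional ℝ E] {D V : Set E} {ι : Type*} {l : Filter ι}
    (hV : IsOpen V) (hVD : V ⊆ D) {φ : E → ℝ} {φseq : ι → E → ℝ} (hφ : ContinuousOn φ D)
    (hd : ∀ j, DifferentiableOn ℝ (φseq j) V)
    (hconv : TendstoUniformlyOn φseq φ l D) {p x : E} (hxV : x ∈ V)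
    (hmax : IsMaxOn (fun z => ⟪p, z⟫ - φ z) D x)
    (huniq : {x ∈ D | IsMaxOn (fun z => ⟪p, z⟫ - φ z) D x}.Subsingleton) :
    ∀ᶠ j in l, p ∈ gradient (φseq j) '' V := by
  obtain ⟨ρ, hρ, hball⟩ := Metric.nhds_basis_closedBall.mem_iff.1 (hV.mem_nhds hxV)
  have hcont : ∀ s : Set E, ContinuousOn (fun z : E => ⟪p, z⟫) s := fun s =>
    (by fun_prop : Continuous fun z : E => ⟪p, z⟫).continuousOn
  have hstrict : ∀ z ∈ Metric.sphere x ρ, φ x - ⟪p, x⟫ < φ z - ⟪p, z⟫ := by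
    intro z hz
    have hzD : z ∈ D := hVD (hball (Metric.sphere_subset_closedBall hz))
    by_contra! hle
    have hz' : z = x := huniq ⟨hzD, fun w hw => by
      have := hmax hw
      simp only [Set.mem_ofPred_eq] at this ⊢
      linarith⟩ ⟨hVD hxV, hmax⟩
    rw [hz', Metric.mem_sphere, dist_self] at hz
    exact hρ.ne hz
  obtain ⟨a, ha, haS⟩ := (isCompact_sphere x ρ).exists_forall_le'
    ((hφ.mono fun z hz => hVD (hball (Metric.sphere_subset_closedBall hz))).sub (hcont _)) hstrict
  filter_upwards [Metric.tendstoUniformlyOn_iff.1 hconv ((a - (φ x - ⟪p, x⟫)) / 2) (by linarith)]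
    with j hj
  obtain ⟨y, hy, hymin⟩ := (isCompact_closedBall x ρ).exists_isMinOn
    ⟨x, Metric.mem_closedBall_self hρ.le⟩ (((hd j).continuousOn.mono hball).sub (hcont _))
  have hyx := hymin (Metric.mem_closedBall_self hρ.le)
  simp only [Set.mem_ofPred_eq, Pi.sub_apply] at hyx
  have h1 := abs_lt.1 ((Real.dist_eq _ _).symm.trans_lt (hj x (hVD hxV)))
  have h2 := abs_lt.1 ((Real.dist_eq _ _).symm.trans_lt (hj y (hVD (hball hy))))
  have hyb : y ∈ Metric.ball x ρ := by
    refine Metric.mem_ball.2 (lt_of_le_of_ne (Metric.mem_closedBall.1 hy) fun h => ?_)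
    have := haS y h
    simp only [Pi.sub_apply] at this
    linarith [h1.1, h1.2, h2.1, h2.2]
  have hloc : IsLocalMin (fun z => φseq j z - innerSL ℝ p z) y :=
    hymin.isLocalMin
      (Filter.mem_of_superset (Metric.isOpen_ball.mem_nhds hyb) Metric.ball_subset_closedBall)
  have hdy := (hd j).differentiableAt (hV.mem_nhds (hball hy))
  have h0 : fderiv ℝ (φseq j) y = innerSL ℝ p :=
    sub_eq_zero.1 (hloc.hasFDerivAt_eq_zero (hdy.hasFDerivAt.sub (innerSL ℝ p).hasFDerivAt))
  refine ⟨y, hball hy, ?_⟩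
  rw [gradient, h0, LinearIsometryEquiv.symm_apply_eq]
  ext v
  simp

/-- Bounded `L log L` integrals give uniformly small integrals on sets of small measure. -/
theorem exists_lintegral_le_of_integral_mul_log_lt {α : Type*} [MeasurableSpace α]
    (ν : Measure α) (C : ℝ) {ε : ENNReal} (hε : ε ≠ 0) :
    ∃ δ : ENNReal, δ ≠ 0 ∧ ∀ (B : Set α) (g : α → ℝ), MeasurableSet B → (∀ x ∈ B, 0 ≤ g x) →
      IntegrableOn (fun x => g x * Real.log (1 + g x)) B ν →
      ∫ x in B, g x * Real.log (1 + g x) ∂ν < C →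
      ∀ V ⊆ B, MeasurableSet V → ν V < δ → ∫⁻ x in V, ENNReal.ofReal (g x) ∂ν ≤ ε := by
  have hlim : Filter.Tendsto (fun M : ℝ => ENNReal.ofReal (C / Real.log (1 + M))) Filter.atTop
      (nhds 0) := by
    have h : Filter.Tendsto (fun M : ℝ => C / Real.log (1 + M)) Filter.atTop (nhds 0) :=
      (Real.tendsto_log_atTop.comp (Filter.tendsto_atTop_add_const_left _ 1
        Filter.tendsto_id)).const_div_atTop C
    simpa using ENNReal.tendsto_ofReal h
  obtain ⟨M, hMε, hM⟩ := ((hlim.eventually_le_const (ENNReal.half_pos hε)).and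
    (Filter.eventually_gt_atTop 0)).exists
  have hlog : 0 < Real.log (1 + M) := Real.log_pos (by linarith)
  refine ⟨ε / 2 / ENNReal.ofReal M, (ENNReal.div_pos (ENNReal.half_pos hε).ne'
    ENNReal.ofReal_ne_top).ne', fun B g hB hg hint hC V hVB hV hVδ => ?_⟩
  have hnn : ∀ x ∈ B, 0 ≤ g x * Real.log (1 + g x) := fun x hx =>
    mul_nonneg (hg x hx) (Real.log_nonneg (by linarith [hg x hx]))
  have hpt : ∀ x ∈ V, ENNReal.ofReal (g x) ≤ ENNReal.ofReal M +
      ENNReal.ofReal (g x * Real.log (1 + g x) / Real.log (1 + M)) := by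
    intro x hx
    have hgx := hg x (hVB hx)
    rw [← ENNReal.ofReal_add hM.le (div_nonneg (hnn x (hVB hx)) hlog.le)]
    refine ENNReal.ofReal_le_ofReal ?_
    rcases le_total (g x) M with h | h
    · linarith [div_nonneg (hnn x (hVB hx)) hlog.le]
    · have : g x ≤ g x * Real.log (1 + g x) / Real.log (1 + M) := by
        rw [le_div_iff₀ hlog]
        exact mul_le_mul_of_nonneg_left
          (Real.log_le_log (by linarith) (by linarith)) hgx
      linarith
  calc ∫⁻ x in V, ENNReal.ofReal (g x) ∂ν
      ≤ ∫⁻ x in V, (ENNReal.ofReal M +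
          ENNReal.ofReal (g x * Real.log (1 + g x) / Real.log (1 + M))) ∂ν :=
        setLIntegral_mono' hV hpt
    _ = ENNReal.ofReal M * ν V +
          ∫⁻ x in V, ENNReal.ofReal (g x * Real.log (1 + g x) / Real.log (1 + M)) ∂ν := by
        rw [lintegral_add_left measurable_const, setLIntegral_const]
    _ ≤ ε / 2 + ε / 2 := by
        gcongr
        · rw [mul_comm]
          exact ENNReal.mul_le_of_le_div hVδ.le
        · refine (lintegral_mono_set hVB).trans ?_
          rw [← ofReal_integral_eq_lintegral_ofReal (hint.div_const _)
            ((ae_restrict_iff' hB).2 (.of_forall fun x hx => div_nonneg (hnn x hx) hlog.le)),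
            integral_div]
          exact (ENNReal.ofReal_le_ofReal (div_le_div_of_nonneg_right hC.le hlog.le)).trans hMε
    _ = ε := ENNReal.add_halves ε

/-- The subdifferential image of a subset of an open set `V` is no larger than a bound which
frequently holds for the gradient images of `V` under approximants. -/
theorem volume_iUnion_subdiffOn_le {n : ℕ} {Ω D E V : Set (EuclideanSpace ℝ (Fin n))}
    {φ : EuclideanSpace ℝ (Fin n) → ℝ} {φseq : ℕ → EuclideanSpace ℝ (Fin n) → ℝ}
    (hD : IsCompact D) (hDΩ : D ⊆ Ω) (hV : IsOpen V) (hVD : V ⊆ D) (hEV : E ⊆ V)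
    (hφ : ContinuousOn φ D) (hd : ∀ j, DifferentiableOn ℝ (φseq j) V)
    (hconv : TendstoUniformlyOn φseq φ Filter.atTop D) {ε : ENNReal}
    (hε : ∃ᶠ j in Filter.atTop, volume (gradient (φseq j) '' V) ≤ ε) :
    volume (⋃ x ∈ E, subdiffOn Ω φ x) ≤ ε := by
  let S : ℕ → Set (EuclideanSpace ℝ (Fin n)) := fun J => ⋂ j ≥ J, gradient (φseq j) '' V
  have hS : Monotone S := fun J K hJK =>
    Set.biInter_subset_biInter_left fun j (hj : K ≤ j) => hJK.trans hj
  calc volume (⋃ x ∈ E, subdiffOn Ω φ x) ≤ volume (⋃ J, S J) := by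
        refine measure_mono_ae ?_
        filter_upwards [hD.ae_subsingleton_isMaxOn hφ volume] with p hp hpE
        obtain ⟨x, hxE, hpx⟩ := Set.mem_iUnion₂.1 hpE
        obtain ⟨J, hJ⟩ := Filter.eventually_atTop.1 (eventually_mem_image_gradient hV hVD hφ hd
          hconv (hEV hxE) (fun z hz => by
            have := hpx z (hDΩ hz)
            rw [inner_sub_right] at this
            simp only [Set.mem_ofPred_eq]
            linarith) hp)
        exact Set.mem_iUnion.2 ⟨J, Set.mem_iInter₂.2 hJ⟩
    _ = ⨆ J, volume (S J) := hS.measure_iUnion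
    _ ≤ ε := iSup_le fun J => by
        obtain ⟨j, hj, hjε⟩ := Filter.frequently_atTop.1 hε J
        exact (measure_mono (Set.biInter_subset_of_mem hj)).trans hjε

/-- let `φ` be convex on open `Ω ⊂ ℝⁿ` whose Monge–Ampère measure `μ` has a
nontrivial singular part w.r.t. Lebesgue measure. Then for every sequence of smooth convex
`φ_j → φ` locally uniformly on `Ω`, every `z₀` in the support of the singular part, and every
ball `B_r(z₀)` compactly contained in `Ω`, the Hardy norms
`∫_{B_r(z₀)} det(Hφ_j) log(1 + det(Hφ_j))` tend to `+∞`. -/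
theorem hardy_norm_blowup (n : ℕ) (hn : 1 ≤ n)
    (Ω : Set (EuclideanSpace ℝ (Fin n))) (hΩ : IsOpen Ω)
    (φ : EuclideanSpace ℝ (Fin n) → ℝ) (hφ : ConvexOn ℝ Ω φ)
    (μ : Measure (EuclideanSpace ℝ (Fin n)))
    (hμ : ∀ E : Set (EuclideanSpace ℝ (Fin n)), MeasurableSet E → E ⊆ Ω →
      μ E = volume (⋃ x ∈ E, subdiffOn Ω φ x))
    (hsing : μ.singularPart volume ≠ 0)
    (z₀ : EuclideanSpace ℝ (Fin n)) (hz₀Ω : z₀ ∈ Ω)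
    (hz₀ : ∀ ρ : ℝ, 0 < ρ → 0 < μ.singularPart volume (Metric.ball z₀ ρ))
    (φseq : ℕ → EuclideanSpace ℝ (Fin n) → ℝ)
    (hsm : ∀ j, ContDiffOn ℝ (⊤ : ℕ∞) (φseq j) Ω) (hcv : ∀ j, ConvexOn ℝ Ω (φseq j))
    (hconv : TendstoLocallyUniformlyOn φseq φ Filter.atTop Ω)
    (r : ℝ) (hr : 0 < r) (hrΩ : Metric.closedBall z₀ r ⊆ Ω) :
    Filter.Tendsto
      (fun j => ∫ x in Metric.ball z₀ r,
        (Hess (φseq j) x).det * Real.log (1 + (Hess (φseq j) x).det))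
      Filter.atTop Filter.atTop := by
  by_contra hnot
  obtain ⟨C, hC⟩ : ∃ C, ∃ᶠ j in Filter.atTop, ∫ x in Metric.ball z₀ r,
      (Hess (φseq j) x).det * Real.log (1 + (Hess (φseq j) x).det) < C := by
    simpa only [Filter.tendsto_atTop, not_forall, Filter.not_eventually, not_le] using hnot
  have hBΩ : Metric.ball z₀ r ⊆ Ω := Metric.ball_subset_closedBall.trans hrΩ
  have hs2 : ∀ j, ContDiffOn ℝ 2 (φseq j) Ω := fun j => (hsm j).of_le (WithTop.coe_le_coe.2 le_top)
  have hf1 : ∀ j, ContDiffOn ℝ 1 (fderiv ℝ (φseq j)) Ω := fun j =>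
    (hs2 j).fderiv_of_isOpen hΩ (by norm_num)
  have hd2 : ∀ j, ∀ x ∈ Ω, DifferentiableAt ℝ (fderiv ℝ (φseq j)) x := fun j x hx =>
    ((hf1 j).differentiableOn (by norm_num)).differentiableAt (hΩ.mem_nhds hx)
  have hnn : ∀ j, ∀ x ∈ Ω, 0 ≤ (Hess (φseq j) x).det := fun j x hx =>
    (hcv j).hess_det_nonneg hΩ (hs2 j) hx
  have hHcont : ∀ j, ContinuousOn (Hess (φseq j)) Ω := fun j => by
    refine continuousOn_pi.2 fun i => continuousOn_pi.2 fun k => ?_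
    refine ContinuousOn.congr ?_ fun x hx => hess_apply (hd2 j x hx) i k
    exact (((hf1 j).continuousOn_fderiv_of_isOpen hΩ le_rfl).clm_apply
      continuousOn_const).clm_apply continuousOn_const
  have hdcont : ∀ j, ContinuousOn (fun x => (Hess (φseq j) x).det) Ω := fun j =>
    (continuous_id.matrix_det).comp_continuousOn (hHcont j)
  have hint : ∀ j, IntegrableOn (fun x => (Hess (φseq j) x).det *
      Real.log (1 + (Hess (φseq j) x).det)) (Metric.ball z₀ r) volume := fun j => by
    have hc : ContinuousOn (fun x => (Hess (φseq j) x).det *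
        Real.log (1 + (Hess (φseq j) x).det)) (Metric.closedBall z₀ r) :=
      ((hdcont j).mul ((continuousOn_const.add (hdcont j)).log fun x hx =>
        (by linarith [hnn j x hx] : (0 : ℝ) < 1 + (Hess (φseq j) x).det).ne')).mono hrΩ
    exact (hc.integrableOn_compact (isCompact_closedBall z₀ r)).mono_set
      Metric.ball_subset_closedBall
  have hconvD : TendstoUniformlyOn φseq φ Filter.atTop (Metric.closedBall z₀ r) :=
    (tendstoLocallyUniformlyOn_iff_forall_isCompact hΩ).1 hconv _ hrΩ (isCompact_closedBall z₀ r)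
  have hnull : ∀ E ⊆ Metric.ball z₀ r, MeasurableSet E → volume E = 0 → μ E = 0 := by
    intro E hEB hE hE0
    by_contra hne
    rw [hμ E hE (hEB.trans hBΩ)] at hne
    obtain ⟨ε, hε0, hε⟩ := exists_between (pos_iff_ne_zero.2 hne)
    obtain ⟨δ, hδ, hsmall⟩ := exists_lintegral_le_of_integral_mul_log_lt
      (volume : Measure (EuclideanSpace ℝ (Fin n))) C hε0.ne'
    obtain ⟨U, hEU, hU, hUδ⟩ := E.exists_isOpen_lt_of_lt δ (hE0.trans_lt (pos_iff_ne_zero.2 hδ))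
    have hVo : IsOpen (U ∩ Metric.ball z₀ r) := hU.inter Metric.isOpen_ball
    have hVΩ : U ∩ Metric.ball z₀ r ⊆ Ω := Set.inter_subset_right.trans hBΩ
    refine hε.not_ge (volume_iUnion_subdiffOn_le (isCompact_closedBall z₀ r) hrΩ hVo
      (Set.inter_subset_right.trans Metric.ball_subset_closedBall) (Set.subset_inter hEU hEB)
      ((hφ.continuousOn hΩ).mono hrΩ)
      (fun j => ((hs2 j).differentiableOn (by norm_num)).mono hVΩ) hconvD
      (hC.mono fun j hj => ?_))
    refine (addHaar_image_le_lintegral_abs_det_fderiv volume hVo.measurableSet fun x hx =>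
      (hasFDerivAt_gradient (hd2 j x (hVΩ hx))).differentiableAt.hasFDerivAt.hasFDerivWithinAt).trans
      ?_
    refine (setLIntegral_congr_fun hVo.measurableSet fun x hx => ?_).trans_le
      (hsmall _ (fun x => (Hess (φseq j) x).det) measurableSet_ball
        (fun x hx => hnn j x (hBΩ hx)) (hint j) hj _ Set.inter_subset_right hVo.measurableSet
        ((measure_mono Set.inter_subset_left).trans_lt hUδ))
    rw [det_fderiv_gradient (hd2 j x (hVΩ hx)), abs_of_nonneg (hnn j x (hVΩ hx))]
  obtain ⟨S, hS, hS0, hSc⟩ := Measure.mutuallySingular_singularPart μ volume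
  refine (hz₀ r hr).ne' (le_antisymm ?_ zero_le)
  calc μ.singularPart volume (Metric.ball z₀ r)
      ≤ μ.singularPart volume S + μ.singularPart volume (Metric.ball z₀ r ∩ Sᶜ) :=
        (measure_mono fun x hx => (em (x ∈ S)).imp id fun h => ⟨hx, h⟩).trans
          (measure_union_le _ _)
    _ ≤ 0 + μ (Metric.ball z₀ r ∩ Sᶜ) := by
        rw [hS0]
        gcongr
        exact Measure.singularPart_le μ volume
    _ = 0 := by
        rw [hnull _ Set.inter_subset_left (measurableSet_ball.inter hS.compl)
          (measure_mono_null Set.inter_subset_right hSc), add_zero]
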